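/- arXiv:1305.1831 — 2 statements merged into one kernel-verified Lean document; each statement's English description precedes it below -/
import Mathlib

section
/- Let q = 3^m with m odd and m not divisible by 3. For all integers a, b with 0 ≤ a ≤ q − 2 and 0 ≤ b ≤ q − 2, we have w(a) + w(b) + w(s) ≥ m, where s is the unique integer with 0 ≤ s ≤ q − 2 and s ≡ (q−1)/2 − 7a − 5b (mod q − 1). -/
/-- A potential on the carries of the base-3 addition `7a + 5b + s`; along each step between
carries at most 12 its increase is at most the digit weight consumed minus one. -/
def carryPotential (c : ℕ) : ℕ :=
  if c = 0 ∨ c = 2 then 0 else if c = 1 ∨ c = 3 ∨ c = 5 then 1 else 2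

theorem carryPotential_step {x y z c d : ℕ} (hx : x < 3) (hy : y < 3) (hz : z < 3)
    (hc : c ≤ 12) (h : 7 * x + 5 * y + z + c = 1 + 3 * d) :
    1 + carryPotential d ≤ x + y + z + carryPotential c := by
  unfold carryPotential
  interval_cases x <;> interval_cases y <;> split_ifs <;> omega

theorem digits_three_sum (n : ℕ) :
    (Nat.digits 3 n).sum = n % 3 + (Nat.digits 3 (n / 3)).sum := by
  rcases Nat.eq_zero_or_pos n with rfl | hn
  · simp
  · rw [Nat.digits_def' (by norm_num) hn, List.sum_cons]

/-- If adding `7a + 5b + s` to an incoming carry `c ≤ 12` produces the base-3 number `1⋯1` (`m` ones)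
with outgoing carry `d`, then the total digit weight is at least `m` plus the potential gained. -/
theorem add_carryPotential_le_digits_sum (m : ℕ) {a b s c d : ℕ}
    (ha : a < 3 ^ m) (hb : b < 3 ^ m) (hs : s < 3 ^ m)
    (hc : c ≤ 12) (h : 2 * (7 * a + 5 * b + s + c) + 1 = 3 ^ m + 2 * (3 ^ m * d)) :
    m + carryPotential d ≤ (Nat.digits 3 a).sum + (Nat.digits 3 b).sum +
      (Nat.digits 3 s).sum + carryPotential c := by
  induction m generalizing a b s c with
  | zero =>
    obtain rfl : c = d := by omega
    omega
  | succ m ih =>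
    rw [pow_succ] at ha hb hs h
    have hmul : 3 ^ m * 3 * d = 3 * (3 ^ m * d) := by ring
    rw [hmul] at h
    have hodd : 3 ^ m % 2 = 1 := Nat.odd_iff.mp (Odd.pow (by decide))
    obtain ⟨e, he⟩ : ∃ e, 7 * (a % 3) + 5 * (b % 3) + s % 3 + c = 1 + 3 * e :=
      ⟨(7 * (a % 3) + 5 * (b % 3) + s % 3 + c - 1) / 3, by omega⟩
    have hrec := ih (a := a / 3) (b := b / 3) (s := s / 3) (c := e)
      (by omega) (by omega) (by omega) (by omega) (by omega)
    have hstep := carryPotential_step (Nat.mod_lt a (by norm_num)) (Nat.mod_lt b (by norm_num))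
      (Nat.mod_lt s (by norm_num)) hc he
    rw [digits_three_sum a, digits_three_sum b, digits_three_sum s]
    omega

/-- For `q = 3^m` with `m` odd and `3 ∤ m`, and all `0 ≤ a, b ≤ q − 2`,
`w(a) + w(b) + w(((q−1)/2 − 7a − 5b) mod (q−1)) ≥ m`, where `w` denotes the
ternary digit sum. -/
theorem weight_sum_ge_m_two_variables
    (m : ℕ) (hm : Odd m) (hm3 : ¬ (3 ∣ m))
    (a b : ℕ) (ha : a ≤ 3 ^ m - 2) (hb : b ≤ 3 ^ m - 2) :
    m ≤ (Nat.digits 3 a).sum + (Nat.digits 3 b).sum +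
      (Nat.digits 3 ((((3 ^ m - 1 : ℤ) / 2 - 7 * (a : ℤ) - 5 * (b : ℤ)) %
        ((3 : ℤ) ^ m - 1)).toNat)).sum := by
  have hq : 3 ≤ 3 ^ m := le_self_pow (by norm_num) hm.pos.ne'
  have hodd : 3 ^ m % 2 = 1 := Nat.odd_iff.mp (Odd.pow (by decide))
  have hcast : (3 : ℤ) ^ m = ((3 ^ m : ℕ) : ℤ) := by push_cast; rfl
  rw [hcast]
  generalize hQ : 3 ^ m = q at *
  set t : ℤ := ((q : ℤ) - 1) / 2 - 7 * (a : ℤ) - 5 * (b : ℤ) with ht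
  have hdiv := Int.mul_ediv_add_emod t ((q : ℤ) - 1)
  have hnonneg := Int.emod_nonneg t (b := (q : ℤ) - 1) (by omega)
  have hlt := Int.emod_lt_of_pos t (b := (q : ℤ) - 1) (by omega)
  obtain ⟨s, hs⟩ := Int.eq_ofNat_of_zero_le hnonneg
  rw [hs] at hdiv hlt ⊢
  have hk : 0 ≤ -(t / ((q : ℤ) - 1)) := by
    by_contra! hneg
    have : (q : ℤ) - 1 ≤ ((q : ℤ) - 1) * (t / ((q : ℤ) - 1)) :=
      le_mul_of_one_le_right (by omega) (by omega)
    omega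
  obtain ⟨k, hk⟩ := Int.eq_ofNat_of_zero_le hk
  obtain hk' : t / ((q : ℤ) - 1) = -k := by omega
  rw [hk'] at hdiv
  have hexp : ((q : ℤ) - 1) * -k = k - ((q * k : ℕ) : ℤ) := by push_cast; ring
  rw [hexp] at hdiv
  have hk12 : k ≤ 12 := by
    by_contra! hlarge
    have : 13 * ((q : ℤ) - 1) ≤ k * ((q : ℤ) - 1) :=
      mul_le_mul_of_nonneg_right (by omega) (by omega)
    have : (k : ℤ) * ((q : ℤ) - 1) = ((q * k : ℕ) : ℤ) - k := by push_cast; ring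
    omega
  have key := add_carryPotential_le_digits_sum m (a := a) (b := b) (s := s) (c := k) (d := k)
    (by omega) (by omega) (by omega) hk12 (by rw [hQ]; omega)
  rw [Int.toNat_natCast]
  omega
end

section
/- Let q = 3^m with m odd and m not divisible by 3, and let u, β be nonzero elements of GF(q). Then 2·Σ_{y ∈ D_u} ξ₃^{Tr(β·y)} + 1 = Σ_{x ∈ GF(q)^*} ξ₃^{Tr(β·D_7(x,u))}·χ(x), where ξ₃ = e^{2πi/3}, Tr is the trace from GF(q) to GF(3), and χ is the quadratic character of GF(q)^* (χ(x) = 1 if x is a nonzero square and χ(x) = −1 if x is a nonsquare). -/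
/-- The `n`-th power map is injective on `{a | a ^ N = a}` when `n` is coprime to `N - 1`. -/
theorem eq_of_pow_eq_pow_of_coprime {K : Type*} [Field K] {n N : ℕ} (hn : n ≠ 0) (hN : N ≠ 0)
    (h : Nat.Coprime n (N - 1)) {a b : K} (ha : a ^ N = a) (hb : b ^ N = b)
    (hab : a ^ n = b ^ n) : a = b := by
  rcases eq_or_ne b 0 with rfl | hb0
  · rw [zero_pow hn] at hab
    exact pow_eq_zero_iff hn |>.mp hab
  · have hbn : b ^ n ≠ 0 := pow_ne_zero _ hb0
    have ha0 : a ≠ 0 := by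
      rintro rfl
      rw [zero_pow hn] at hab
      exact hbn hab.symm
    have h1 : (a / b) ^ n = 1 := by rw [div_pow, hab, div_self hbn]
    have h2 : (a / b) ^ (N - 1) = 1 := by
      have hc : a / b ≠ 0 := div_ne_zero ha0 hb0
      apply mul_right_cancel₀ hc
      rw [pow_sub_one_mul hN, div_pow, ha, hb, one_mul]
    have h3 : (a / b) ^ Nat.gcd n (N - 1) = 1 := pow_gcd_eq_one.mpr ⟨h1, h2⟩
    rw [h, pow_one] at h3
    exact (div_eq_one_iff_eq hb0).mp h3

theorem coprime_seven_nine_pow_sub_one {m : ℕ} (hm : ¬ 3 ∣ m) :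
    Nat.Coprime 7 (9 ^ m - 1) := by
  rw [Nat.Prime.coprime_iff_not_dvd (by norm_num)]
  intro h
  have h1 : 9 ^ m % 7 = 1 := by
    have : 0 < 9 ^ m := by positivity
    omega
  have h2 : 9 ^ m = 729 ^ (m / 3) * 9 ^ (m % 3) := by
    conv_lhs => rw [← Nat.div_add_mod m 3, pow_add, pow_mul]
    norm_num
  rw [h2, Nat.mul_mod, Nat.pow_mod] at h1
  have h3 : m % 3 = 1 ∨ m % 3 = 2 := by omega
  rcases h3 with h3 | h3 <;> simp [h3] at h1

/-- In an algebraically closed extension of a field with `3 ^ m` elements, elements of the base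
field split as sums with a prescribed product, both summands being fixed by `a ↦ a ^ 9 ^ m`. -/
theorem exists_add_mul_eq_pow_eq_self {F K : Type*} [Field F] [Fintype F] [Field K] [IsAlgClosed K]
    [Algebra F K] [CharP K 3] {m : ℕ} (hcard : Fintype.card F = 3 ^ m) (x u : F) :
    ∃ z v : K, z + v = algebraMap F K x ∧ z * v = algebraMap F K u ∧
      z ^ 9 ^ m = z ∧ v ^ 9 ^ m = v := by
  have : Fact (Nat.Prime 3) := ⟨Nat.prime_three⟩
  set X := algebraMap F K x
  set U := algebraMap F K u
  have hX : X ^ 3 ^ m = X := by rw [← map_pow, ← hcard, FiniteField.pow_card]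
  have hU : U ^ 3 ^ m = U := by rw [← map_pow, ← hcard, FiniteField.pow_card]
  have hfix : ∀ z v : K, z + v = X → z * v = U → z ^ 9 ^ m = z := by
    intro z v hs hp
    have hs' : z ^ 3 ^ m + v ^ 3 ^ m = X := by rw [← add_pow_char_pow, hs, hX]
    have hp' : z ^ 3 ^ m * v ^ 3 ^ m = U := by rw [← mul_pow, hp, hU]
    have h9 : z ^ 9 ^ m = (z ^ 3 ^ m) ^ 3 ^ m := by
      rw [← pow_mul, ← mul_pow]; norm_num
    rw [h9]
    have hroot : (z ^ 3 ^ m - z) * (z ^ 3 ^ m - v) = 0 := by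
      linear_combination z ^ 3 ^ m * (hs' - hs) - hp' + hp
    rcases mul_eq_zero.mp hroot with h | h
    · rw [sub_eq_zero.mp h, sub_eq_zero.mp h]
    · rw [sub_eq_zero.mp h]
      linear_combination hs' - hs - h
  obtain ⟨z, hz⟩ := IsAlgClosed.exists_root
    (Polynomial.X ^ 2 - Polynomial.C X * Polynomial.X + Polynomial.C U : Polynomial K) (by
      have : (Polynomial.X ^ 2 - Polynomial.C X * Polynomial.X + Polynomial.C U :
        Polynomial K).degree = 2 := by compute_degree!
      rw [this]; norm_num)
  simp only [Polynomial.IsRoot.def, Polynomial.eval_add, Polynomial.eval_sub, Polynomial.eval_pow,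
    Polynomial.eval_X, Polynomial.eval_mul, Polynomial.eval_C] at hz
  have hp : z * (X - z) = U := by linear_combination -hz
  exact ⟨z, X - z, by ring, hp, hfix z (X - z) (by ring) hp,
    hfix (X - z) z (by ring) (by rw [mul_comm, hp])⟩

/-- The Dickson polynomial of order 7 is injective on a field with `3 ^ m` elements, `3 ∤ m`. -/
theorem dickson_seven_injective {F : Type*} [Field F] [Fintype F] [CharP F 3] {m : ℕ}
    (hm : ¬ 3 ∣ m) (hcard : Fintype.card F = 3 ^ m) (u : F) :
    Function.Injective (fun x : F => x ^ 7 - u * x ^ 5 - u ^ 2 * x ^ 3 - u ^ 3 * x) := by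
  intro x y hxy
  let K := AlgebraicClosure F
  have : CharP K 3 := charP_of_injective_algebraMap (algebraMap F K).injective 3
  have h3 : (3 : K) = 0 := by exact_mod_cast CharP.cast_eq_zero K 3
  have hident : ∀ z v : K, (z + v) ^ 7 - z * v * (z + v) ^ 5 - (z * v) ^ 2 * (z + v) ^ 3
      - (z * v) ^ 3 * (z + v) = z ^ 7 + v ^ 7 := by
    intro z v
    linear_combination (2 * z * v * (z + v) ^ 5 - 5 * (z * v) ^ 2 * (z + v) ^ 3
      + 2 * (z * v) ^ 3 * (z + v)) * h3
  obtain ⟨z, v, hs, hp, hz, hv⟩ := exists_add_mul_eq_pow_eq_self (K := K) hcard x u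
  obtain ⟨w, t, hs', hp', hw, ht⟩ := exists_add_mul_eq_pow_eq_self (K := K) hcard y u
  have hE := congrArg (algebraMap F K) hxy
  simp only [map_sub, map_mul, map_pow, ← hs, ← hs'] at hE
  rw [← hp, hident, hp, ← hp', hident] at hE
  have hP : z ^ 7 * v ^ 7 = w ^ 7 * t ^ 7 := by rw [← mul_pow, ← mul_pow, hp, hp']
  have hroot : (z ^ 7 - w ^ 7) * (z ^ 7 - t ^ 7) = 0 := by
    linear_combination z ^ 7 * hE - hP
  have hinj : ∀ {a b : K}, a ^ 9 ^ m = a → b ^ 9 ^ m = b → a ^ 7 = b ^ 7 → a = b :=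
    eq_of_pow_eq_pow_of_coprime (by norm_num) (by positivity)
      (coprime_seven_nine_pow_sub_one hm)
  apply (algebraMap F K).injective
  rw [← hs, ← hs']
  rcases mul_eq_zero.mp hroot with h | h
  · have hzw := sub_eq_zero.mp h
    rw [hinj hz hw hzw, hinj hv ht (by linear_combination hE - hzw)]
  · have hzt := sub_eq_zero.mp h
    rw [hinj hz ht hzt, hinj hv hw (by linear_combination hE - hzt), add_comm]

/-- A nontrivial cubic additive character sums to zero over the field. -/
theorem sum_cube_root_pow_trace_eq_zero {F : Type*} [Field F] [Fintype F] [Algebra (ZMod 3) F]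
    {ζ : ℂ} (hζ : IsPrimitiveRoot ζ 3) {β : F} (hβ : β ≠ 0) :
    ∑ y : F, ζ ^ (Algebra.trace (ZMod 3) F (β * y)).val = 0 := by
  have : Fact (Nat.Prime 3) := ⟨Nat.prime_three⟩
  let ψ : AddChar F ℂ := (AddChar.zmodChar 3 hζ.pow_eq_one).compAddMonoidHom
    ((Algebra.trace (ZMod 3) F).toAddMonoidHom.comp (AddMonoidHom.mulLeft β))
  have hψ : ∀ y, ψ y = ζ ^ (Algebra.trace (ZMod 3) F (β * y)).val := fun y => rfl
  simp_rw [← hψ]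
  apply AddChar.sum_eq_zero_of_ne_one
  intro h
  obtain ⟨c, hc⟩ := Algebra.trace_surjective (ZMod 3) F 1
  have h1 : ψ (β⁻¹ * c) = 1 := by rw [h]; rfl
  rw [hψ, mul_inv_cancel_left₀ hβ, hc, ZMod.val_one, pow_one] at h1
  exact hζ.ne_one (by norm_num) h1


/-- The additive character sum over `D_u` relates to the quadratic-twisted character
sum: `2·ψ_β(D_u) + 1 = Σ_{x ≠ 0} ξ₃^{Tr(β·D₇(x,u))} χ(x)`. -/
theorem two_mul_char_sum_over_Du_add_one
    (m : ℕ) (hm : Odd m) (hm3 : ¬ (3 ∣ m)) (F : Type*) [Field F] [Fintype F]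
    [DecidableEq F] [Algebra (ZMod 3) F] (hcard : Fintype.card F = 3 ^ m)
    (u β : F) (hu : u ≠ 0) (hβ : β ≠ 0) :
    2 * ∑ y ∈ (Finset.univ.filter (fun x : F => x ≠ 0)).image
          (fun x => (x ^ 2) ^ 7 - u * (x ^ 2) ^ 5 - u ^ 2 * (x ^ 2) ^ 3 - u ^ 3 * x ^ 2),
        (Complex.exp (2 * Real.pi * Complex.I / 3)) ^ ((Algebra.trace (ZMod 3) F (β * y)).val)
      + 1
    = ∑ x ∈ Finset.univ.filter (fun x : F => x ≠ 0),
        (Complex.exp (2 * Real.pi * Complex.I / 3)) ^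
            ((Algebra.trace (ZMod 3) F
              (β * (x ^ 7 - u * x ^ 5 - u ^ 2 * x ^ 3 - u ^ 3 * x))).val) *
          (if IsSquare x then (1 : ℂ) else -1) := by
  have : Fact (Nat.Prime 3) := ⟨Nat.prime_three⟩
  have : CharP F 3 := charP_of_injective_algebraMap (algebraMap (ZMod 3) F).injective 3
  have hζ : IsPrimitiveRoot (Complex.exp (2 * Real.pi * Complex.I / 3)) 3 := by
    simpa using Complex.isPrimitiveRoot_exp 3 (by norm_num)
  set ζ := Complex.exp (2 * Real.pi * Complex.I / 3)
  set D : F → F := fun x => x ^ 7 - u * x ^ 5 - u ^ 2 * x ^ 3 - u ^ 3 * x with hD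
  have hinj : Function.Injective D := dickson_seven_injective hm3 hcard u
  have himage : (Finset.univ.filter (fun x : F => x ≠ 0)).image
      (fun x => (x ^ 2) ^ 7 - u * (x ^ 2) ^ 5 - u ^ 2 * (x ^ 2) ^ 3 - u ^ 3 * x ^ 2) =
      ((Finset.univ.filter (fun x : F => x ≠ 0)).filter IsSquare).image D := by
    ext y
    simp only [Finset.mem_image, Finset.mem_filter, Finset.mem_univ, true_and]
    constructor
    · rintro ⟨x, hx, rfl⟩
      exact ⟨x ^ 2, ⟨pow_ne_zero 2 hx, IsSquare.sq x⟩, rfl⟩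
    · rintro ⟨s, ⟨hs, r, rfl⟩, rfl⟩
      exact ⟨r, left_ne_zero_of_mul hs, by simp only [hD]; ring⟩
  have hzero : ∑ x : F, ζ ^ (Algebra.trace (ZMod 3) F (β * D x)).val = 0 := by
    rw [← sum_cube_root_pow_trace_eq_zero hζ hβ]
    exact (Finite.injective_iff_bijective.mp hinj).sum_comp
      (fun y => ζ ^ (Algebra.trace (ZMod 3) F (β * y)).val)
  have hnonzero : ∑ x ∈ Finset.univ.filter (fun x : F => x ≠ 0),
      ζ ^ (Algebra.trace (ZMod 3) F (β * D x)).val = -1 := by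
    rw [← Finset.add_sum_erase _ _ (Finset.mem_univ 0)] at hzero
    have hD0 : D 0 = 0 := by simp [hD]
    rw [hD0, mul_zero, map_zero, ZMod.val_zero, pow_zero] at hzero
    rw [Finset.filter_ne']
    linear_combination hzero
  rw [himage, Finset.sum_image hinj.injOn, Finset.sum_filter, Finset.mul_sum]
  refine Eq.trans (congrArg₂ (· + ·) rfl (neg_eq_iff_eq_neg.mpr hnonzero).symm) ?_
  rw [← sub_eq_add_neg, ← Finset.sum_sub_distrib]
  refine Finset.sum_congr rfl fun x _ => ?_
  split_ifs <;> simp only [hD] <;> ring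
end
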